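/- Let N, t ≥ 1 and let H' be a 5-uniform hypergraph on vertex set {0, 1, ..., N−1} such that every set of t+1 vertices of H' contains 6 vertices all of whose 5-subsets are edges of H'. Define a 6-uniform hypergraph H on {0, 1, ..., 2^N − 1} by: a 6-tuple e = (a_1 < ... < a_6) is an edge of H if and only if either (I) m(e) = 0 and {δ_1, ..., δ_5} is an edge of H', or (II) m(e) ∈ {2, 3} and δ_1 < δ_2, or (III) m(e) = 3, δ_1 > δ_2, and moreover δ_1 > δ_3 or δ_3 < δ_5. Then every set of 8t vertices of H contains 7 vertices all of whose 6-subsets are edges of H. -/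

import Mathlib

/-- For distinct nonnegative integers `a` and `b`, `bdelta a b` is the largest index `i`
such that the `i`-th binary digits of `a` and `b` differ. -/
noncomputable def bdelta (a b : ℕ) : ℕ := sSup {i | a.testBit i ≠ b.testBit i}

/-- For a tuple `a 1 < a 2 < ⋯` of nonnegative integers, `dseq a i = δ(a i, a (i+1))`. -/
noncomputable def dseq (a : ℕ → ℕ) (i : ℕ) : ℕ := bdelta (a i) (a (i + 1))

/-- The index `i` is a local extremum of the δ-sequence of the tuple `a`:
`δ_{i-1} < δ_i > δ_{i+1}` or `δ_{i-1} > δ_i < δ_{i+1}`. -/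
def IsLocalExt (a : ℕ → ℕ) (i : ℕ) : Prop :=
  (dseq a (i - 1) < dseq a i ∧ dseq a (i + 1) < dseq a i) ∨
    (dseq a i < dseq a (i - 1) ∧ dseq a i < dseq a (i + 1))

open Classical in
/-- `numExtrema r a` is `m(e)`: the number of local extrema of the δ-sequence
`δ_1, …, δ_{r-1}` of an increasing `r`-tuple `e = (a 1, …, a r)`; the possible local extrema
are the indices `2 ≤ i ≤ r - 2`. -/
noncomputable def numExtrema (r : ℕ) (a : ℕ → ℕ) : ℕ :=
  ((Finset.Icc 2 (r - 2)).filter (fun i => IsLocalExt a i)).card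

/-- The δ-sequence `δ_1, …, δ_{r-1}` of the `r`-tuple `(a 1, …, a r)` is strictly monotone. -/
def DMonotone (r : ℕ) (a : ℕ → ℕ) : Prop :=
  (∀ i, 1 ≤ i → i + 1 ≤ r - 1 → dseq a i < dseq a (i + 1)) ∨
    (∀ i, 1 ≤ i → i + 1 ≤ r - 1 → dseq a (i + 1) < dseq a i)

theorem bdelta_lt_iff {a b : ℕ} (h : a ≠ b) (k : ℕ) :
    bdelta a b < k ↔ a / 2 ^ k = b / 2 ^ k := by
  have hne : {i | a.testBit i ≠ b.testBit i}.Nonempty := Nat.exists_testBit_ne_of_ne h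
  have hbdd : BddAbove {i | a.testBit i ≠ b.testBit i} := by
    refine ⟨a + b, fun i hi => ?_⟩
    by_contra! hlt
    have h2 : i < 2 ^ i := Nat.lt_two_pow_self
    exact hi (by rw [Nat.testBit_lt_two_pow (by omega), Nat.testBit_lt_two_pow (by omega)])
  constructor
  · intro hk
    refine Nat.eq_of_testBit_eq fun i => ?_
    rw [Nat.testBit_div_two_pow, Nat.testBit_div_two_pow]
    by_contra hi
    have := le_csSup hbdd (show i + k ∈ {i | a.testBit i ≠ b.testBit i} from hi)
    have hk' : sSup {i | a.testBit i ≠ b.testBit i} < k := hk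
    omega
  · intro hk
    by_contra! hlt
    refine Nat.sSup_mem hne hbdd ?_
    change a.testBit (bdelta a b) = b.testBit (bdelta a b)
    have h1 := Nat.testBit_div_two_pow (n := k) a (bdelta a b - k)
    have h2 := Nat.testBit_div_two_pow (n := k) b (bdelta a b - k)
    rw [Nat.sub_add_cancel hlt] at h1 h2
    rw [← h1, ← h2, hk]

theorem bdelta_eq_max {a b c : ℕ} (hab : a < b) (hbc : b < c) :
    bdelta a c = max (bdelta a b) (bdelta b c) := by
  refine eq_of_forall_gt_iff fun k => ?_
  rw [max_lt_iff, bdelta_lt_iff hab.ne, bdelta_lt_iff hbc.ne, bdelta_lt_iff (hab.trans hbc).ne]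
  have h1 := Nat.div_le_div_right (c := 2 ^ k) hab.le
  have h2 := Nat.div_le_div_right (c := 2 ^ k) hbc.le
  omega

theorem bdelta_ne {a b c : ℕ} (hab : a < b) (hbc : b < c) : bdelta a b ≠ bdelta b c := by
  intro h
  have h1 := bdelta_lt_iff hab.ne (bdelta a b)
  have h2 := bdelta_lt_iff hbc.ne (bdelta a b)
  have h3 := (bdelta_lt_iff hab.ne (bdelta a b + 1)).1 (Nat.lt_succ_self _)
  have h4 := (bdelta_lt_iff hbc.ne (bdelta a b + 1)).1 (h ▸ Nat.lt_succ_self _)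
  rw [← h] at h2
  simp only [lt_irrefl, false_iff] at h1 h2
  have h5 := Nat.div_le_div_right (c := 2 ^ bdelta a b) hab.le
  have h6 := Nat.div_le_div_right (c := 2 ^ bdelta a b) hbc.le
  rw [pow_succ, ← Nat.div_div_eq_div_mul, ← Nat.div_div_eq_div_mul] at h3 h4
  omega

theorem bdelta_lt {a b N : ℕ} (hab : a < b) (hb : b < 2 ^ N) : bdelta a b < N := by
  rw [bdelta_lt_iff hab.ne, Nat.div_eq_of_lt hb, Nat.div_eq_of_lt (hab.trans hb)]

theorem bdelta_le_bdelta {x y z w : ℕ} (hxy : x ≤ y) (hyz : y < z) (hzw : z ≤ w) :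
    bdelta y z ≤ bdelta x w := by
  have h1 : bdelta y z ≤ bdelta y w := by
    rcases hzw.eq_or_lt with rfl | h
    · rfl
    · rw [bdelta_eq_max hyz h]; exact le_max_left _ _
  refine h1.trans ?_
  rcases hxy.eq_or_lt with rfl | h
  · rfl
  · rw [bdelta_eq_max h (hyz.trans_le hzw)]; exact le_max_right _ _

open Classical in
theorem numExtrema_six (a : ℕ → ℕ) :
    numExtrema 6 a = (if IsLocalExt a 2 then 1 else 0) + (if IsLocalExt a 3 then 1 else 0) +
      (if IsLocalExt a 4 then 1 else 0) := by
  have h : Finset.Icc 2 (6 - 2) = {2, 3, 4} := by decide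
  rw [numExtrema, h, Finset.card_filter, Finset.sum_insert (by decide),
    Finset.sum_insert (by decide), Finset.sum_singleton, add_assoc]

/-- The sequence `b` with its `k`-th term removed. -/
def skipAt (k : ℕ) (b : ℕ → ℕ) (j : ℕ) : ℕ := if j < k then b j else b (j + 1)

theorem skipAt_lt {b : ℕ → ℕ} (hb : ∀ i, 1 ≤ i → i < 7 → b i < b (i + 1)) (k i : ℕ)
    (h1 : 1 ≤ i) (h6 : i < 6) : skipAt k b i < skipAt k b (i + 1) := by
  have h2 := hb i h1 (by omega)
  have h3 := hb (i + 1) (by omega) (by omega)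
  unfold skipAt
  split_ifs <;> omega

theorem dseq_skipAt {b : ℕ → ℕ} (hb : ∀ i, 1 ≤ i → i < 7 → b i < b (i + 1)) (k i : ℕ)
    (h1 : 1 ≤ i) (h6 : i < 6) :
    dseq (skipAt k b) i = if i + 1 < k then dseq b i
      else if i + 1 = k then max (dseq b i) (dseq b (i + 1)) else dseq b (i + 1) := by
  unfold dseq skipAt
  split_ifs
  all_goals first
    | rfl
    | omega
    | exact bdelta_eq_max (hb i h1 (by omega)) (hb (i + 1) (by omega) (by omega))

theorem exists_seven_of_skipAt {b : ℕ → ℕ} (hb : ∀ i, 1 ≤ i → i < 7 → b i < b (i + 1))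
    {W : Finset ℕ} (hW : ∀ i, 1 ≤ i → i ≤ 7 → b i ∈ W) {E : Finset ℕ → Prop}
    (hE : ∀ k, 1 ≤ k → k ≤ 7 → E ((Finset.Icc 1 6).image (skipAt k b))) :
    ∃ S ⊆ W, S.card = 7 ∧ ∀ e ⊆ S, e.card = 6 → E e := by
  have hmono : StrictMonoOn b (Set.Icc 1 7) :=
    strictMonoOn_of_lt_add_one Set.ordConnected_Icc
      fun i _ hi hi' => hb i hi.1 (by have := hi'.2; omega)
  have hinj : Set.InjOn b (Finset.Icc 1 7 : Finset ℕ) := by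
    rw [Finset.coe_Icc]; exact hmono.injOn
  have hcard : ((Finset.Icc 1 7).image b).card = 7 := by
    rw [Finset.card_image_of_injOn hinj]; rfl
  refine ⟨(Finset.Icc 1 7).image b, ?_, hcard, fun e he hecard => ?_⟩
  · intro x hx
    obtain ⟨i, hi, rfl⟩ := Finset.mem_image.1 hx
    rw [Finset.mem_Icc] at hi
    exact hW i hi.1 hi.2
  · obtain ⟨x, hx, hxe⟩ := Finset.exists_mem_notMem_of_card_lt_card
      (show e.card < ((Finset.Icc 1 7).image b).card by omega)
    obtain ⟨k, hk, rfl⟩ := Finset.mem_image.1 hx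
    rw [Finset.mem_Icc] at hk
    have hsub : e ⊆ (Finset.Icc 1 6).image (skipAt k b) := by
      intro y hy
      obtain ⟨i, hi, rfl⟩ := Finset.mem_image.1 (he hy)
      rw [Finset.mem_Icc] at hi
      have hik : i ≠ k := fun h => hxe (h ▸ hy)
      rw [Finset.mem_image]
      rcases hik.lt_or_gt with h | h
      · exact ⟨i, Finset.mem_Icc.2 (by omega), by simp [skipAt, h]⟩
      · refine ⟨i - 1, Finset.mem_Icc.2 (by omega), ?_⟩
        rw [skipAt, if_neg (by omega), Nat.sub_add_cancel hi.1]
    rw [Finset.eq_of_subset_of_card_le hsub (Finset.card_image_le.trans (by simp [hecard]))]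
    exact hE k hk.1 hk.2

theorem exists_enumeration (J : Finset ℕ) {n : ℕ} (hn : J.card = n) :
    ∃ f : ℕ → ℕ, (∀ i, i < n → f i ∈ J) ∧ ∀ i k, i < k → k < n → f i < f k := by
  refine ⟨fun i => if h : i < n then J.orderEmbOfFin hn ⟨i, h⟩ else 0, fun i hi => ?_,
    fun i k hik hk => ?_⟩
  · simp only [dif_pos hi]
    exact Finset.orderEmbOfFin_mem _ _ _
  · simp only [dif_pos hk, dif_pos (hik.trans hk)]
    exact (J.orderEmbOfFin hn).strictMono hik

/-- The edge condition relating the 6-uniform hypergraph `E` to the 5-uniform hypergraph `E'`. -/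
def IsStepUp (N : ℕ) (E' E : Finset ℕ → Prop) : Prop :=
  ∀ a : ℕ → ℕ, (∀ i, 1 ≤ i → i < 6 → a i < a (i + 1)) → a 6 < 2 ^ N →
    (E ((Finset.Icc 1 6).image a) ↔
      (DMonotone 6 a ∧
        E' ({dseq a 1, dseq a 2, dseq a 3, dseq a 4, dseq a 5} : Finset ℕ)) ∨
      ((numExtrema 6 a = 2 ∨ numExtrema 6 a = 3) ∧ dseq a 1 < dseq a 2) ∨
      (numExtrema 6 a = 3 ∧ dseq a 2 < dseq a 1 ∧
        (dseq a 3 < dseq a 1 ∨ dseq a 3 < dseq a 5)))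

theorem skipAt_six_mem {b : ℕ → ℕ} {W : Finset ℕ} (hW : ∀ i, 1 ≤ i → i ≤ 7 → b i ∈ W) (k : ℕ) :
    skipAt k b 6 ∈ W := by
  unfold skipAt
  split_ifs
  · exact hW 6 (by omega) (by omega)
  · exact hW 7 (by omega) (by omega)

theorem IsStepUp.exists_seven_of_zigzag {N : ℕ} {E' E : Finset ℕ → Prop} (hE : IsStepUp N E' E)
    {W : Finset ℕ} (hWN : W ⊆ Finset.range (2 ^ N)) {b : ℕ → ℕ}
    (hb : ∀ i, 1 ≤ i → i < 7 → b i < b (i + 1)) (hW : ∀ i, 1 ≤ i → i ≤ 7 → b i ∈ W)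
    (h12 : dseq b 1 < dseq b 2) (h32 : dseq b 3 < dseq b 2) (h34 : dseq b 3 < dseq b 4)
    (h54 : dseq b 5 < dseq b 4) (h56 : dseq b 5 < dseq b 6)
    (h : dseq b 4 < dseq b 2 ∨ dseq b 4 < dseq b 6) :
    ∃ S ⊆ W, S.card = 7 ∧ ∀ e ⊆ S, e.card = 6 → E e := by
  refine exists_seven_of_skipAt hb hW fun k hk1 hk7 => ?_
  refine (hE _ (skipAt_lt hb k) (Finset.mem_range.1 (hWN (skipAt_six_mem hW k)))).2 (Or.inr ?_)
  have hd := dseq_skipAt hb k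
  have hne3 := bdelta_ne (skipAt_lt hb k 2 (by omega) (by omega))
    (skipAt_lt hb k 3 (by omega) (by omega))
  have hne4 := bdelta_ne (skipAt_lt hb k 3 (by omega) (by omega))
    (skipAt_lt hb k 4 (by omega) (by omega))
  have hne5 := bdelta_ne (skipAt_lt hb k 4 (by omega) (by omega))
    (skipAt_lt hb k 5 (by omega) (by omega))
  change dseq (skipAt k b) 2 ≠ dseq (skipAt k b) 3 at hne3
  change dseq (skipAt k b) 3 ≠ dseq (skipAt k b) 4 at hne4
  change dseq (skipAt k b) 4 ≠ dseq (skipAt k b) 5 at hne5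
  have e1 := hd 1 (by omega) (by omega)
  have e2 := hd 2 (by omega) (by omega)
  have e3 := hd 3 (by omega) (by omega)
  have e4 := hd 4 (by omega) (by omega)
  have e5 := hd 5 (by omega) (by omega)
  clear hd
  rw [numExtrema_six]
  split_ifs with c2 c3 c4 c4 c3 c4 c4 <;>
    simp only [IsLocalExt, Nat.reduceSub, Nat.reduceAdd, or_true, true_or, true_and] at * <;>
    interval_cases k <;> simp at e1 e2 e3 e4 e5 <;> omega

theorem IsStepUp.exists_seven_of_monotone {N : ℕ} {E' E : Finset ℕ → Prop}
    (hE : IsStepUp N E' E) {W : Finset ℕ} (hWN : W ⊆ Finset.range (2 ^ N)) {b : ℕ → ℕ}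
    (hb : ∀ i, 1 ≤ i → i < 7 → b i < b (i + 1)) (hW : ∀ i, 1 ≤ i → i ≤ 7 → b i ∈ W)
    (hmono : DMonotone 7 b) {S : Finset ℕ} (hS : ∀ e ⊆ S, e.card = 5 → E' e)
    (hbS : ∀ i, 1 ≤ i → i ≤ 6 → dseq b i ∈ S) :
    ∃ S ⊆ W, S.card = 7 ∧ ∀ e ⊆ S, e.card = 6 → E e := by
  refine exists_seven_of_skipAt hb hW fun k hk1 hk7 => ?_
  refine (hE _ (skipAt_lt hb k) (Finset.mem_range.1 (hWN (skipAt_six_mem hW k)))).2 (Or.inl ?_)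
  have hd := dseq_skipAt hb k
  have hmem : ∀ i, 1 ≤ i → i < 6 → dseq (skipAt k b) i ∈ S := by
    intro i h1 h6
    rw [hd i h1 h6]
    split_ifs
    · exact hbS i h1 (by omega)
    · rcases max_choice (dseq b i) (dseq b (i + 1)) with h | h <;> rw [h]
      · exact hbS i h1 (by omega)
      · exact hbS (i + 1) (by omega) (by omega)
    · exact hbS (i + 1) (by omega) (by omega)
  have hskip : DMonotone 6 (skipAt k b) := by
    refine hmono.imp (fun h i h1 h6 => ?_) (fun h i h1 h6 => ?_) <;>
    · rw [hd i h1 (by omega), hd (i + 1) (by omega) (by omega)]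
      have h2 := h i h1 (by omega)
      have h3 := h (i + 1) (by omega) (by omega)
      split_ifs <;> omega
  refine ⟨hskip, hS _ ?_ ?_⟩
  · intro x hx
    simp only [Finset.mem_insert, Finset.mem_singleton] at hx
    rcases hx with rfl | rfl | rfl | rfl | rfl <;> exact hmem _ (by omega) (by omega)
  · have hlt : (dseq (skipAt k b) 1 < dseq (skipAt k b) 2 ∧
        dseq (skipAt k b) 2 < dseq (skipAt k b) 3 ∧ dseq (skipAt k b) 3 < dseq (skipAt k b) 4 ∧
        dseq (skipAt k b) 4 < dseq (skipAt k b) 5) ∨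
        (dseq (skipAt k b) 2 < dseq (skipAt k b) 1 ∧
        dseq (skipAt k b) 3 < dseq (skipAt k b) 2 ∧ dseq (skipAt k b) 4 < dseq (skipAt k b) 3 ∧
        dseq (skipAt k b) 5 < dseq (skipAt k b) 4) :=
      hskip.imp
        (fun h => ⟨h 1 (by omega) (by omega), h 2 (by omega) (by omega), h 3 (by omega) (by omega),
          h 4 (by omega) (by omega)⟩)
        (fun h => ⟨h 1 (by omega) (by omega), h 2 (by omega) (by omega), h 3 (by omega) (by omega),
          h 4 (by omega) (by omega)⟩)
    iterate 4
      rw [Finset.card_insert_of_notMem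
        (by simp only [Finset.mem_insert, Finset.mem_singleton]; omega)]
    rw [Finset.card_singleton]

/-- Along a window on which the δ-sequence increases, `δ` is given by its last term. -/
theorem bdelta_eq_dseq_right {a : ℕ → ℕ} {s r : ℕ}
    (ha : ∀ i j, s ≤ i → i < j → j ≤ r + 1 → a i < a j)
    (hup : ∀ i, s ≤ i → i < r → dseq a i < dseq a (i + 1)) (u v : ℕ) (hu : s ≤ u) (huv : u ≤ v)
    (hv : v ≤ r) : bdelta (a u) (a (v + 1)) = dseq a v := by
  induction v, huv using Nat.le_induction with
  | base => rfl
  | succ v huv ih =>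
    rw [bdelta_eq_max (ha u (v + 1) hu (by omega) (by omega))
      (ha (v + 1) (v + 1 + 1) (by omega) (by omega) (by omega)), ih (by omega)]
    exact max_eq_right (hup v (by omega) (by omega)).le

/-- Along a window on which the δ-sequence decreases, `δ` is given by its first term. -/
theorem bdelta_eq_dseq_left {a : ℕ → ℕ} {s r : ℕ}
    (ha : ∀ i j, s ≤ i → i < j → j ≤ r + 1 → a i < a j)
    (hdown : ∀ i, s ≤ i → i < r → dseq a (i + 1) < dseq a i) (u v : ℕ) (hu : s ≤ u) (huv : u ≤ v)
    (hv : v ≤ r) : bdelta (a u) (a (v + 1)) = dseq a u := by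
  have hle : ∀ w, u ≤ w → w ≤ r → dseq a w ≤ dseq a u := fun w huw => by
    induction w, huw using Nat.le_induction with
    | base => exact fun _ => le_rfl
    | succ w huw ih => exact fun h => (hdown w (by omega) (by omega)).le.trans (ih (by omega))
  induction v, huv using Nat.le_induction with
  | base => rfl
  | succ v huv ih =>
    rw [bdelta_eq_max (ha u (v + 1) hu (by omega) (by omega))
      (ha (v + 1) (v + 1 + 1) (by omega) (by omega) (by omega)), ih (by omega)]
    exact max_eq_left (hle (v + 1) (by omega) hv)

theorem IsStepUp.exists_seven_of_window {N t : ℕ} {E' E : Finset ℕ → Prop} (hE : IsStepUp N E' E)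
    (hE' : ∀ T ⊆ Finset.range N, T.card = t + 1 →
      ∃ S ⊆ T, S.card = 6 ∧ ∀ e ⊆ S, e.card = 5 → E' e)
    {W : Finset ℕ} (hWN : W ⊆ Finset.range (2 ^ N)) {a : ℕ → ℕ} {s : ℕ}
    (ha : ∀ i j, s ≤ i → i < j → j ≤ s + t + 1 → a i < a j)
    (haW : ∀ i, s ≤ i → i ≤ s + t + 1 → a i ∈ W)
    (hmono : (∀ i, s ≤ i → i < s + t → dseq a i < dseq a (i + 1)) ∨
      (∀ i, s ≤ i → i < s + t → dseq a (i + 1) < dseq a i)) :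
    ∃ S ⊆ W, S.card = 7 ∧ ∀ e ⊆ S, e.card = 6 → E e := by
  have hstrict : StrictMonoOn (dseq a) (Set.Icc s (s + t)) ∨
      StrictAntiOn (dseq a) (Set.Icc s (s + t)) :=
    hmono.imp
      (fun h => strictMonoOn_of_lt_add_one Set.ordConnected_Icc
        fun i _ hi hi' => h i hi.1 (by have := hi'.2; omega))
      (fun h => strictAntiOn_of_add_one_lt Set.ordConnected_Icc
        fun i _ hi hi' => h i hi.1 (by have := hi'.2; omega))
  have hinj : Set.InjOn (dseq a) (Finset.Icc s (s + t) : Finset ℕ) := by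
    rw [Finset.coe_Icc]; exact hstrict.elim StrictMonoOn.injOn StrictAntiOn.injOn
  obtain ⟨S, hST, hScard, hS⟩ := hE' ((Finset.Icc s (s + t)).image (dseq a))
    (fun x hx => by
      obtain ⟨i, hi, rfl⟩ := Finset.mem_image.1 hx
      rw [Finset.mem_Icc] at hi
      exact Finset.mem_range.2 (bdelta_lt (ha i (i + 1) hi.1 (by omega) (by omega))
        (Finset.mem_range.1 (hWN (haW (i + 1) (by omega) (by omega))))))
    (by rw [Finset.card_image_of_injOn hinj, Nat.card_Icc]; omega)
  obtain ⟨J, hJ, rfl⟩ := Finset.subset_image_iff.1 hST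
  rw [Finset.card_image_of_injOn (hinj.mono hJ)] at hScard
  obtain ⟨f, hfJ, hf⟩ := exists_enumeration J hScard
  have hfs : ∀ i, i < 6 → s ≤ f i ∧ f i ≤ s + t := fun i hi => Finset.mem_Icc.1 (hJ (hfJ i hi))
  have key : ∀ b : ℕ → ℕ, (∀ i, 1 ≤ i → i < 7 → b i < b (i + 1)) →
      (∀ i, 1 ≤ i → i ≤ 7 → b i ∈ W) → (∀ i, 1 ≤ i → i ≤ 6 → dseq b i = dseq a (f (i - 1))) →
      ∃ S ⊆ W, S.card = 7 ∧ ∀ e ⊆ S, e.card = 6 → E e := by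
    intro b hb hbW hdb
    refine hE.exists_seven_of_monotone hWN hb hbW ?_ hS fun i h1 h6 => ?_
    · refine hstrict.imp (fun h i h1 h6 => ?_) (fun h i h1 h6 => ?_) <;>
      · rw [hdb i h1 (by omega), hdb (i + 1) (by omega) (by omega)]
        exact h (hfs _ (by omega)) (hfs _ (by omega)) (hf _ _ (by omega) (by omega))
    · rw [hdb i h1 h6]
      exact Finset.mem_image_of_mem _ (hfJ _ (by omega))
  rcases hmono with hup | hdown
  · refine key (fun i => if i = 1 then a s else a (f (i - 2) + 1)) ?_ ?_ ?_
    · intro i h1 h7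
      have hfi := hfs (i - 1) (by omega)
      by_cases hi : i = 1
      · subst hi
        simp only [if_true]
        exact ha _ _ le_rfl (by simpa using Nat.lt_succ_of_le hfi.1) (by simpa using hfi.2)
      · simp only [if_neg hi, if_neg (show i + 1 ≠ 1 by omega)]
        have := hfs (i - 2) (by omega)
        exact ha _ _ (by omega) (by simpa using hf (i - 2) (i - 1) (by omega) (by omega))
          (by simpa using hfi.2)
    · intro i h1 h7
      split_ifs with hi
      · exact haW s le_rfl (by omega)
      · have := hfs (i - 2) (by omega)
        exact haW _ (by omega) (by omega)
    · intro i h1 h6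
      have hfi := hfs (i - 1) (by omega)
      have hr := bdelta_eq_dseq_right (r := s + t) ha hup
      unfold dseq at hr ⊢
      by_cases hi : i = 1
      · subst hi
        exact hr _ _ le_rfl hfi.1 hfi.2
      · have := hf (i - 2) (i - 1) (by omega) (by omega)
        have := hfs (i - 2) (by omega)
        simp only [if_neg hi, if_neg (show i + 1 ≠ 1 by omega)]
        exact hr _ (f (i - 1)) (by omega) (by omega) hfi.2
  · refine key (fun i => if i = 7 then a (s + t + 1) else a (f (i - 1))) ?_ ?_ ?_
    · intro i h1 h7
      have hfi := hfs (i - 1) (by omega)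
      simp only [if_neg h7.ne]
      split_ifs with hi
      · exact ha _ _ hfi.1 (by omega) le_rfl
      · have := hfs i (by omega)
        exact ha _ _ hfi.1 (hf _ _ (by omega) (by omega)) (by simp; omega)
    · intro i h1 h7
      split_ifs with hi
      · exact haW _ (by omega) le_rfl
      · have := hfs (i - 1) (by omega)
        exact haW _ (by omega) (by omega)
    · intro i h1 h6
      have hfi := hfs (i - 1) (by omega)
      have hr := bdelta_eq_dseq_left (r := s + t) ha hdown
      unfold dseq at hr ⊢
      simp only [if_neg (show i ≠ 7 by omega)]
      split_ifs with hi
      · exact hr _ _ hfi.1 hfi.2 le_rfl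
      · have := hf (i - 1) i (by omega) (by omega)
        have := hfs i (by omega)
        have h := hr (f (i - 1)) (f i - 1) hfi.1 (by omega) (by omega)
        rw [Nat.sub_add_cancel (by omega)] at h
        exact h

/-- Between a descent at `k` and a later ascent at `j` there is a local minimum. -/
theorem exists_local_min {D : ℕ → ℕ} {k j : ℕ} (hkj : k < j)
    (hne : ∀ i, i ≤ j → D i ≠ D (i + 1)) (hk : D (k + 1) < D k) (hj : D j < D (j + 1)) :
    ∃ p, k ≤ p ∧ p + 1 ≤ j ∧ D (p + 1) < D p ∧ D (p + 1) < D (p + 2) := by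
  induction j, hkj using Nat.le_induction with
  | base => exact ⟨k, le_rfl, le_rfl, hk, hj⟩
  | succ j hkj ih =>
    by_cases h : D j < D (j + 1)
    · obtain ⟨p, h1, h2, h3⟩ := ih (fun i hi => hne i (by omega)) h
      exact ⟨p, h1, by omega, h3⟩
    · have hnej := hne j (by omega)
      exact ⟨j, by omega, le_rfl, by omega, hj⟩

/-- Let `N, t ≥ 1` and let `E'` be a 5-uniform hypergraph on `{0,…,N-1}` such that every set
of `t+1` vertices contains 6 vertices all of whose 5-subsets are edges. Define a 6-uniform
hypergraph `E` on `{0,…,2^N - 1}` by: a 6-tuple `e = (a₁ < ⋯ < a₆)` is an edge iff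
(I) `m(e) = 0` (its δ-sequence is strictly monotone) and `{δ₁,…,δ₅}` is an edge of `E'`, or
(II) `m(e) ∈ {2, 3}` and `δ₁ < δ₂`, or (III) `m(e) = 3`, `δ₁ > δ₂`, and moreover `δ₁ > δ₃` or
`δ₃ < δ₅`. Then every set of `8t` vertices of `E` contains 7 vertices all of whose 6-subsets
are edges. -/
theorem stmt19 (N t : ℕ) (hN : 1 ≤ N) (ht : 1 ≤ t) (E' : Finset ℕ → Prop)
    (hE' : ∀ T ⊆ Finset.range N, T.card = t + 1 →
      ∃ S ⊆ T, S.card = 6 ∧ ∀ e ⊆ S, e.card = 5 → E' e)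
    (E : Finset ℕ → Prop)
    (hE : ∀ a : ℕ → ℕ, (∀ i, 1 ≤ i → i < 6 → a i < a (i + 1)) → a 6 < 2 ^ N →
      (E ((Finset.Icc 1 6).image a) ↔
        (DMonotone 6 a ∧
          E' ({dseq a 1, dseq a 2, dseq a 3, dseq a 4, dseq a 5} : Finset ℕ)) ∨
        ((numExtrema 6 a = 2 ∨ numExtrema 6 a = 3) ∧ dseq a 1 < dseq a 2) ∨
        (numExtrema 6 a = 3 ∧ dseq a 2 < dseq a 1 ∧
          (dseq a 3 < dseq a 1 ∨ dseq a 3 < dseq a 5)))) :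
    ∀ W ⊆ Finset.range (2 ^ N), W.card = 8 * t →
      ∃ S ⊆ W, S.card = 7 ∧ ∀ e ⊆ S, e.card = 6 → E e := by
  intro W hWN hWcard
  have hstep : IsStepUp N E' E := hE
  by_contra hno
  obtain ⟨a, haW, ha⟩ := exists_enumeration W hWcard
  have hne : ∀ i, i + 2 < 8 * t → dseq a i ≠ dseq a (i + 1) := fun i hi =>
    bdelta_ne (ha i (i + 1) (by omega) (by omega)) (ha (i + 1) (i + 2) (by omega) (by omega))
  have hup : ∀ s, s + t + 1 < 8 * t → ∃ i, s ≤ i ∧ i < s + t ∧ dseq a i < dseq a (i + 1) := by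
    intro s hs
    by_contra! h
    exact hno (hstep.exists_seven_of_window hE' hWN (a := a) (s := s)
      (fun i j _ hij hj => ha i j hij (by omega)) (fun i _ hi => haW i (by omega))
      (Or.inr fun i h1 h2 => (h i h1 h2).lt_of_ne (hne i (by omega)).symm))
  have hdown : ∀ s, s + t + 1 < 8 * t → ∃ i, s ≤ i ∧ i < s + t ∧ dseq a (i + 1) < dseq a i := by
    intro s hs
    by_contra! h
    exact hno (hstep.exists_seven_of_window hE' hWN (a := a) (s := s)
      (fun i j _ hij hj => ha i j hij (by omega)) (fun i _ hi => haW i (by omega))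
      (Or.inl fun i h1 h2 => (h i h1 h2).lt_of_ne (hne i (by omega))))
  have ht2 : 2 ≤ t := by
    by_contra! h
    obtain ⟨i, hi1, hi2, hi3⟩ := hup 0 (by omega)
    obtain ⟨j, hj1, hj2, hj3⟩ := hdown 0 (by omega)
    obtain rfl : i = j := by omega
    omega
  have hmin : ∀ s, s + 2 * t + 1 < 8 * t → ∃ p, s ≤ p ∧ p + 1 < s + 2 * t ∧
      dseq a (p + 1) < dseq a p ∧ dseq a (p + 1) < dseq a (p + 2) := by
    intro s hs
    obtain ⟨k, hk1, hk2, hk3⟩ := hdown s (by omega)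
    obtain ⟨j, hj1, hj2, hj3⟩ := hup (s + t) (by omega)
    obtain ⟨p, h1, h2, h3⟩ := exists_local_min (by omega) (fun i hi => hne i (by omega)) hk3 hj3
    exact ⟨p, by omega, by omega, h3⟩
  obtain ⟨p, hp1, hp2, hp3⟩ := hup 0 (by omega)
  obtain ⟨q, hq1, hq2, hq3, hq4⟩ := hmin t (by omega)
  obtain ⟨r, hr1, hr2, hr3, hr4⟩ := hmin (3 * t) (by omega)
  obtain ⟨u, hu1, hu2, hu3, hu4⟩ := hmin (5 * t) (by omega)
  have hmax : ∀ x y, x + 1 ≤ y → y + 1 < 8 * t → dseq a x < dseq a (x + 1) →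
      dseq a (y + 1) < dseq a y → dseq a x < bdelta (a (x + 1)) (a (y + 1)) ∧
        dseq a (y + 1) < bdelta (a (x + 1)) (a (y + 1)) := by
    intro x y hxy hy hx1 hy1
    have hle : ∀ i j, i ≤ j → j < 8 * t → a i ≤ a j := fun i j hij hj =>
      hij.eq_or_lt.elim (fun h => h ▸ le_rfl) fun h => (ha i j h hj).le
    exact ⟨hx1.trans_le (bdelta_le_bdelta le_rfl (ha _ _ (by omega) (by omega))
        (hle _ _ (by omega) (by omega))),
      hy1.trans_le (bdelta_le_bdelta (hle _ _ hxy (by omega)) (ha _ _ (by omega) (by omega))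
        le_rfl)⟩
  have hzig : ∀ c₁ c₂ c₃ c₄ c₅ c₆ c₇, c₁ < c₂ → c₂ < c₃ → c₃ < c₄ → c₄ < c₅ → c₅ < c₆ → c₆ < c₇ →
      c₇ < 8 * t → bdelta (a c₁) (a c₂) < bdelta (a c₂) (a c₃) →
      bdelta (a c₃) (a c₄) < bdelta (a c₂) (a c₃) → bdelta (a c₃) (a c₄) < bdelta (a c₄) (a c₅) →
      bdelta (a c₅) (a c₆) < bdelta (a c₄) (a c₅) → bdelta (a c₅) (a c₆) < bdelta (a c₆) (a c₇) →
      ¬(bdelta (a c₄) (a c₅) < bdelta (a c₂) (a c₃) ∨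
        bdelta (a c₄) (a c₅) < bdelta (a c₆) (a c₇)) := by
    intro c₁ c₂ c₃ c₄ c₅ c₆ c₇ l1 l2 l3 l4 l5 l6 l7 h1 h2 h3 h4 h5 h6
    refine hno (hstep.exists_seven_of_zigzag hWN
      (b := fun i => a ([0, c₁, c₂, c₃, c₄, c₅, c₆, c₇].getD i 0)) ?_ ?_ h1 h2 h3 h4 h5 h6)
    · intro i hi1 hi7
      interval_cases i <;> exact ha _ _ (by simpa) (by simp; omega)
    · intro i hi1 hi7
      interval_cases i <;> exact haW _ (by simp; omega)
  obtain ⟨m1, m2⟩ := hmax p q (by omega) (by omega) hp3 hq3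
  obtain ⟨m3, m4⟩ := hmax (q + 1) r (by omega) (by omega) hq4 hr3
  obtain ⟨m5, m6⟩ := hmax (r + 1) u (by omega) (by omega) hr4 hu3
  have z1 := hzig p (p + 1) (q + 1) (q + 2) (r + 1) (r + 2) (u + 1) (by omega) (by omega)
    (by omega) (by omega) (by omega) (by omega) (by omega) m1 m2 m3 m4 m5
  have z2 := hzig (q + 1) (q + 2) (r + 1) (r + 2) (u + 1) (u + 2) (u + 3) (by omega) (by omega)
    (by omega) (by omega) (by omega) (by omega) (by omega) m3 m4 m5 m6 hu4
  have hne1 : bdelta (a (q + 2)) (a (r + 1)) ≠ bdelta (a (r + 2)) (a (u + 1)) := by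
    have h := (bdelta_eq_max (ha (q + 2) (r + 1) (by omega) (by omega))
      (ha (r + 1) (r + 2) (by omega) (by omega))).trans (max_eq_left m4.le)
    rw [← h]
    exact bdelta_ne (ha _ _ (by omega) (by omega)) (ha _ _ (by omega) (by omega))
  omega
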